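/- Let B be a unital C*-algebra, I a set, and for every ι ∈ I let A_ι be a unital C*-algebra containing a copy of B as a unital C*-subalgebra, with a conditional expectation φ_ι : A_ι → B whose GNS representation is faithful. Let (A,φ) = (*_B)_{ι∈I}(A_ι,φ_ι) be the reduced amalgamated free product, with each A_ι viewed as a C*-subalgebra of A via the canonical embedding. Then for every ι₀ ∈ I there exists a conditional expectation Φ_{ι₀} : A → A_{ι₀} such that Φ_{ι₀} restricted to A_ι equals φ_ι for every ι ∈ I\{ι₀}, and Φ_{ι₀}(a₁a₂⋯aₙ) = 0 whenever n ≥ 2 and a_j ∈ A_{ι_j} ∩ ker φ_{ι_j} with ι₁ ≠ ι₂, …, ι_{n−1} ≠ ιₙ. -/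

import Mathlib

noncomputable section

/-- A conditional expectation from a unital C⋆-algebra `A` onto a unital C⋆-subalgebra
(the range of the unital embedding `j : B →⋆ₐ[ℂ] A`): a positive, `B`–`B`-bimodule,
idempotent (i.e. restricting to the identity on `B`) contraction. -/
structure IsCondExp {B A : Type*} [CStarAlgebra B] [CStarAlgebra A]
    (j : B →⋆ₐ[ℂ] A) (E : A →ₗ[ℂ] B) : Prop where
  injective : Function.Injective j
  left_inverse : ∀ b : B, E (j b) = b
  bimodule : ∀ (b₁ b₂ : B) (a : A), E (j b₁ * a * j b₂) = b₁ * E a * b₂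
  positive : ∀ a : A, ∃ b : B, E (star a * a) = star b * b
  contractive : ∀ a : A, ‖E a‖ ≤ ‖a‖

/-- The GNS representation of a conditional expectation `E : A → B` (i.e. the left action
of `A` on the Hilbert `B`-module `L²(A,E)` obtained from `A` by separation and completion
with respect to the `B`-valued inner product `⟨a₁, a₂⟩ = E (a₁⋆ * a₂)`) is faithful:
`a` acts as zero on the image of `A` in `L²(A,E)` only if `a = 0`. -/
def FaithfulGNS {B A : Type*} [CStarAlgebra B] [CStarAlgebra A] (E : A →ₗ[ℂ] B) : Prop :=
  ∀ a : A, (∀ x : A, E (star (a * x) * (a * x)) = 0) → a = 0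

/-- `(C, jC, emb, E)` is the reduced amalgamated free product of the unital C⋆-algebras
`A i` over `B` with respect to the conditional expectations `φ i : A i → B` (each having
faithful GNS representation): the `A i` embed into `C` compatibly with the copies of `B`,
`E` is a conditional expectation onto `B` with faithful GNS representation restricting to
`φ i` on each `A i`, the family of copies of the `A i` is free with respect to `E`, and
the copies of the `A i` together generate `C` as a C⋆-algebra.  These properties
characterize the reduced amalgamated free product `(A,φ) = (*_B)_{i ∈ I} (A i, φ i)`
up to canonical isomorphism. -/
structure IsReducedAmalgProd (B : Type*) [CStarAlgebra B] {I : Type*} {A : I → Type*}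
    [∀ i, CStarAlgebra (A i)] (jB : ∀ i, B →⋆ₐ[ℂ] A i) (φ : ∀ i, A i →ₗ[ℂ] B)
    {C : Type*} [CStarAlgebra C] (jC : B →⋆ₐ[ℂ] C) (emb : ∀ i, A i →⋆ₐ[ℂ] C)
    (E : C →ₗ[ℂ] B) : Prop where
  emb_injective : ∀ i, Function.Injective (emb i)
  compat : ∀ i, (emb i).comp (jB i) = jC
  condExp : IsCondExp jC E
  restrict : ∀ i (a : A i), E (emb i a) = φ i a
  faithful : FaithfulGNS E
  free : ∀ (n : ℕ) (ι : Fin (n + 1) → I), (∀ k : Fin n, ι k.castSucc ≠ ι k.succ) →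
    ∀ a : (j : Fin (n + 1)) → A (ι j), (∀ j, φ (ι j) (a j) = 0) →
      E ((List.ofFn fun j => emb (ι j) (a j)).prod) = 0
  generating :
    Dense ((StarAlgebra.adjoin ℂ (⋃ i, Set.range (emb i)) : StarSubalgebra ℂ C) : Set C)

namespace IsCondExp

variable {B C : Type*} [CStarAlgebra B] [CStarAlgebra C] {j : B →⋆ₐ[ℂ] C} {E : C →ₗ[ℂ] B}

lemma map_left_mul (hE : IsCondExp j E) (b : B) (c : C) : E (j b * c) = b * E c := by
  simpa using hE.bimodule b 1 c

lemma map_right_mul (hE : IsCondExp j E) (b : B) (c : C) : E (c * j b) = E c * b := by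
  simpa using hE.bimodule 1 b c

lemma isSelfAdjoint_map_star_mul_self (hE : IsCondExp j E) (c : C) :
    IsSelfAdjoint (E (star c * c)) := by
  obtain ⟨b, hb⟩ := hE.positive c
  rw [hb]
  exact .star_mul_self b

lemma map_star (hE : IsCondExp j E) (c : C) : E (star c) = star (E c) := by
  have h₀ := (hE.isSelfAdjoint_map_star_mul_self c).star_eq
  have h₁ := (hE.isSelfAdjoint_map_star_mul_self 1).star_eq
  have h₂ := (hE.isSelfAdjoint_map_star_mul_self (1 + c)).star_eq
  have h₃ := (hE.isSelfAdjoint_map_star_mul_self (1 + Complex.I • c)).star_eq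
  simp only [star_add, star_one, mul_add, add_mul, one_mul, mul_one, map_add, star_smul,
    smul_mul_assoc, mul_smul_comm, map_smul, h₀, RCLike.star_def, Complex.conj_I, map_neg,
    neg_neg] at h₁ h₂ h₃
  rw [h₁] at h₂ h₃
  have h₂' : star (E c) + star (E (star c)) = E c + E (star c) := by
    linear_combination (norm := module) h₂
  have h₃' : Complex.I • (star (E (star c)) - star (E c)) =
      Complex.I • (E c - E (star c)) := by
    linear_combination (norm := module) h₃
  have h₃'' := smul_right_injective B Complex.I_ne_zero h₃'
  have h : (2 : ℂ) • E (star c) = (2 : ℂ) • star (E c) := by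
    linear_combination (norm := module) h₃'' - h₂'
  exact smul_right_injective B two_ne_zero h

section Order

variable [PartialOrder B] [StarOrderedRing B]

lemma map_star_mul_self_nonneg (hE : IsCondExp j E) (c : C) : 0 ≤ E (star c * c) := by
  obtain ⟨b, hb⟩ := hE.positive c
  rw [hb]
  exact star_mul_self_nonneg b

variable [PartialOrder C] [StarOrderedRing C]

lemma map_nonneg (hE : IsCondExp j E) {c : C} (hc : 0 ≤ c) : 0 ≤ E c := by
  obtain ⟨x, rfl⟩ := CStarAlgebra.nonneg_iff_eq_star_mul_self.mp hc
  exact hE.map_star_mul_self_nonneg x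

lemma map_mono (hE : IsCondExp j E) {c d : C} (h : c ≤ d) : E c ≤ E d := by
  simpa using hE.map_nonneg (sub_nonneg.mpr h)

end Order

lemma map_real_smul (E : C →ₗ[ℂ] B) (r : ℝ) (c : C) : E (r • c) = r • E c :=
  LinearMap.map_smul_of_tower E r c

/-- The Cauchy–Schwarz inequality for the `B`-valued inner product of a conditional
expectation. -/
lemma norm_map_star_mul_sq_le (hE : IsCondExp j E) (p q : C) :
    ‖E (star p * q)‖ ^ 2 ≤ ‖E (star p * p)‖ * ‖E (star q * q)‖ := by
  let _ := CStarAlgebra.spectralOrder B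
  have := CStarAlgebra.spectralOrderedRing B
  set X := E (star p * q) with hX
  have hX' : E (star q * p) = star X := by rw [hX, ← hE.map_star]; simp
  suffices h : ∀ M : ℝ, 0 < M → ‖E (star p * p)‖ ≤ M → ‖X‖ ^ 2 ≤ M * ‖E (star q * q)‖ by
    rw [← sub_nonneg]
    refine le_of_forall_pos_le_add fun ε hε ↦ ?_
    have hd : 0 < ‖E (star q * q)‖ + 1 := by positivity
    have h₁ := h (‖E (star p * p)‖ + ε / (‖E (star q * q)‖ + 1)) (by positivity)
      (le_add_of_nonneg_right (by positivity))
    have h₂ : ε / (‖E (star q * q)‖ + 1) * ‖E (star q * q)‖ ≤ ε := by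
      rw [div_mul_eq_mul_div, div_le_iff₀ hd]
      nlinarith
    nlinarith
  intro M hM hp
  obtain ⟨b, hb⟩ := hE.positive (p * j X - M • q)
  have hexp : E (star (p * j X - M • q) * (p * j X - M • q)) =
      star X * E (star p * p) * X - (2 * M) • (star X * X) + (M * M) • E (star q * q) := by
    have e : star (p * j X - M • q) * (p * j X - M • q) =
        j (star X) * (star p * p) * j X - M • (j (star X) * (star p * q))
          - M • ((star q * p) * j X) + (M * M) • (star q * q) := by
      simp only [star_sub, star_mul, star_smul, star_trivial, StarHomClass.map_star, sub_mul,
        mul_sub, smul_mul_assoc, mul_smul_comm, mul_assoc]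
      module
    rw [e, map_add, map_sub, map_sub, hE.bimodule]
    simp only [map_real_smul, hE.map_left_mul, hE.map_right_mul, hX', ← hX]
    module
  have hle : star X * E (star p * p) * X ≤ M • (star X * X) := by
    have h₁ : E (star p * p) ≤ algebraMap ℝ B M :=
      (IsSelfAdjoint.le_algebraMap_norm_self (hE.isSelfAdjoint_map_star_mul_self p)).trans
        (algebraMap_mono B hp)
    have h₂ := star_left_conjugate_le_conjugate h₁ X
    simpa [Algebra.algebraMap_eq_smul_one] using h₂
  have h₀ : 0 ≤ star b * b := star_mul_self_nonneg b
  rw [← hb, hexp] at h₀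
  have h₃ : M • (star X * X) ≤ (M * M) • E (star q * q) := by
    have h₄ := add_nonneg h₀ (sub_nonneg.mpr hle)
    rw [← sub_nonneg]
    refine h₄.trans_eq ?_
    module
  have h₅ := CStarAlgebra.norm_le_norm_of_nonneg_of_le
    (smul_nonneg hM.le (star_mul_self_nonneg X)) h₃
  rw [norm_smul, norm_smul, CStarRing.norm_star_mul_self, Real.norm_of_nonneg hM.le,
    Real.norm_of_nonneg (by positivity), mul_assoc] at h₅
  simpa [sq] using le_of_mul_le_mul_left h₅ hM

lemma norm_map_star_mul_mul_le (hE : IsCondExp j E) (c q : C) :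
    ‖E (star (c * q) * (c * q))‖ ≤ ‖c‖ ^ 2 * ‖E (star q * q)‖ := by
  let _ := CStarAlgebra.spectralOrder B
  have := CStarAlgebra.spectralOrderedRing B
  let _ := CStarAlgebra.spectralOrder C
  have := CStarAlgebra.spectralOrderedRing C
  have h₁ := star_left_conjugate_le_conjugate
    (CStarAlgebra.star_mul_le_algebraMap_norm_sq (a := c)) q
  have h₂ : star (c * q) * (c * q) ≤ (‖c‖ ^ 2) • (star q * q) := by
    simpa [Algebra.algebraMap_eq_smul_one, mul_assoc] using h₁
  have h₃ := hE.map_mono h₂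
  rw [map_real_smul] at h₃
  have h₄ := CStarAlgebra.norm_le_norm_of_nonneg_of_le (hE.map_star_mul_self_nonneg _) h₃
  rwa [norm_smul, Real.norm_of_nonneg (by positivity)] at h₄

end IsCondExp

/-- If the GNS representation of `E` is faithful, then the norm of `a` is bounded by any bound
for the left multiplication by `a` in the seminorm `‖E (x⋆ x)‖`. -/
lemma FaithfulGNS.norm_le {B A : Type*} [CStarAlgebra B] [CStarAlgebra A] {j : B →⋆ₐ[ℂ] A}
    {E : A →ₗ[ℂ] B} (hE : IsCondExp j E) (hf : FaithfulGNS E) {a : A} {r : ℝ} (hr : 0 ≤ r)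
    (h : ∀ x, ‖E (star (a * x) * (a * x))‖ ≤ r ^ 2 * ‖E (star x * x)‖) : ‖a‖ ≤ r := by
  let _ := CStarAlgebra.spectralOrder B
  have := CStarAlgebra.spectralOrderedRing B
  let _ := CStarAlgebra.spectralOrder A
  have := CStarAlgebra.spectralOrderedRing A
  refine le_of_forall_gt_imp_ge_of_dense fun s hs ↦ ?_
  have hs₀ : 0 < s := hr.trans_lt hs
  set u := star a * a - algebraMap ℝ A (s ^ 2) with hu
  have hu_sa : IsSelfAdjoint u := (IsSelfAdjoint.star_mul_self a).sub (.algebraMap A (.all _))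
  have hg_sa : IsSelfAdjoint (u⁺) := .of_nonneg (CFC.posPart_nonneg u)
  have hgu : u⁺ * u * u⁺ = u⁺ * u⁺ * u⁺ := by
    nth_rw 2 [← CFC.posPart_sub_negPart u hu_sa]
    simp [mul_sub, CFC.posPart_mul_negPart]
  have hpos : 0 ≤ u⁺ * u * u⁺ := by
    rw [hgu]
    simpa [hg_sa.star_eq] using star_left_conjugate_nonneg (CFC.posPart_nonneg u) (u⁺)
  have hg : u⁺ = 0 := by
    refine hf _ fun x ↦ ?_
    have h₁ : (s ^ 2) • (star (u⁺ * x) * (u⁺ * x)) ≤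
        star (a * (u⁺ * x)) * (a * (u⁺ * x)) := by
      rw [← sub_nonneg]
      refine (star_left_conjugate_nonneg hpos x).trans_eq ?_
      nth_rw 2 [hu]
      simp only [star_mul, hg_sa.star_eq, mul_assoc, sub_mul, mul_sub,
        Algebra.algebraMap_eq_smul_one, smul_mul_assoc, mul_smul_comm, one_mul]
    have h₂ := hE.map_mono h₁
    rw [IsCondExp.map_real_smul] at h₂
    have h₃ := CStarAlgebra.norm_le_norm_of_nonneg_of_le
      (smul_nonneg (by positivity) (hE.map_star_mul_self_nonneg _)) h₂
    rw [norm_smul, Real.norm_of_nonneg (by positivity)] at h₃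
    have h₄ := h₃.trans (h _)
    have h₅ : r ^ 2 < s ^ 2 := by gcongr
    rw [← norm_le_zero_iff]
    nlinarith [norm_nonneg (E (star (u⁺ * x) * (u⁺ * x)))]
  rw [CFC.posPart_eq_zero_iff u hu_sa, hu, sub_nonpos,
    ← CStarAlgebra.norm_le_iff_le_algebraMap _ (by positivity) (star_mul_self_nonneg a),
    CStarRing.norm_star_mul_self, ← sq] at hg
  exact le_of_sq_le_sq hg hs₀.le

/-- `a` is the compression of `c` along `j : A → C`, with respect to the inner product given
by `E`. -/
def IsCompression {A B C : Type*} [CStarAlgebra A] [CStarAlgebra B] [CStarAlgebra C]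
    (j : A →⋆ₐ[ℂ] C) (E : C →ₗ[ℂ] B) (c : C) (a : A) : Prop :=
  ∀ x y : A, E (j x * c * j y) = E (j (x * a * y))

namespace IsCompression

section Algebraic

variable {A B C : Type*} [CStarAlgebra A] [CStarAlgebra B] [CStarAlgebra C]
  {j : A →⋆ₐ[ℂ] C} {E : C →ₗ[ℂ] B} {c d : C} {a a' : A}

lemma map (j : A →⋆ₐ[ℂ] C) (E : C →ₗ[ℂ] B) (a : A) : IsCompression j E (j a) a := fun x y ↦ by
  simp

lemma zero (j : A →⋆ₐ[ℂ] C) (E : C →ₗ[ℂ] B) : IsCompression j E 0 0 := fun x y ↦ by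
  simp

lemma add (h : IsCompression j E c a) (h' : IsCompression j E d a') :
    IsCompression j E (c + d) (a + a') := fun x y ↦ by
  have h₁ := h x y
  have h₂ := h' x y
  simp only [mul_add, add_mul, map_add, h₁, h₂]

lemma smul (z : ℂ) (h : IsCompression j E c a) : IsCompression j E (z • c) (z • a) :=
  fun x y ↦ by
    have h₁ := h x y
    simp only [mul_smul_comm, smul_mul_assoc, map_smul, h₁]

lemma sub (h : IsCompression j E c a) (h' : IsCompression j E d a') :
    IsCompression j E (c - d) (a - a') := by
  simpa [sub_eq_add_neg] using h.add (h'.smul (-1))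

lemma mul_mul (h : IsCompression j E c a) (z w : A) :
    IsCompression j E (j z * c * j w) (z * a * w) := fun x y ↦ by
  have h₁ := h (x * z) (w * y)
  simpa only [map_mul, mul_assoc] using h₁

end Algebraic

variable {A B C : Type*} [CStarAlgebra A] [CStarAlgebra B] [CStarAlgebra C]
  {j : A →⋆ₐ[ℂ] C} {E : C →ₗ[ℂ] B} {jB : B →⋆ₐ[ℂ] A} {jC : B →⋆ₐ[ℂ] C} {c d : C} {a a' : A}

lemma star (hE : IsCondExp jC E) (h : IsCompression j E c a) :
    IsCompression j E (star c) (star a) := fun x y ↦ by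
  have h₁ := congrArg Star.star (h (Star.star y) (Star.star x))
  simpa only [← hE.map_star, ← StarHomClass.map_star, star_mul, star_star, mul_assoc] using h₁

lemma norm_le (hE : IsCondExp jC E) (hEj : IsCondExp jB (E ∘ₗ j.toAlgHom.toLinearMap))
    (hf : FaithfulGNS (E ∘ₗ j.toAlgHom.toLinearMap)) (h : IsCompression j E c a) :
    ‖a‖ ≤ ‖c‖ := by
  refine hf.norm_le hEj (norm_nonneg c) fun x ↦ ?_
  change ‖E (j (Star.star (a * x) * (a * x)))‖ ≤ ‖c‖ ^ 2 * ‖E (j (Star.star x * x))‖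
  have h₁ : E (j (Star.star (a * x) * (a * x))) = E (Star.star (j (a * x)) * (c * j x)) := by
    rw [← StarHomClass.map_star, ← mul_assoc (j _), h, ← mul_assoc]
  have h₂ := hE.norm_map_star_mul_sq_le (j (a * x)) (c * j x)
  rw [← h₁, ← StarHomClass.map_star, ← map_mul, sq] at h₂
  rcases (norm_nonneg (E (j (Star.star (a * x) * (a * x))))).eq_or_lt with h₀ | h₀
  · rw [← h₀]
    positivity
  · have h₃ := le_of_mul_le_mul_left h₂ h₀
    simpa only [map_mul, StarHomClass.map_star] using
      h₃.trans (hE.norm_map_star_mul_mul_le c (j x))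

lemma unique (hE : IsCondExp jC E) (hEj : IsCondExp jB (E ∘ₗ j.toAlgHom.toLinearMap))
    (hf : FaithfulGNS (E ∘ₗ j.toAlgHom.toLinearMap)) (h : IsCompression j E c a)
    (h' : IsCompression j E c a') : a = a' := by
  simpa [sub_eq_zero] using (h.sub h').norm_le hE hEj hf

lemma of_tendsto (hE : IsCondExp jC E) (hEj : IsCondExp jB (E ∘ₗ j.toAlgHom.toLinearMap))
    {u : ℕ → C} {v : ℕ → A} (h : ∀ n, IsCompression j E (u n) (v n))
    (hu : Filter.Tendsto u Filter.atTop (nhds c)) (hv : Filter.Tendsto v Filter.atTop (nhds a)) :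
    IsCompression j E c a := fun x y ↦ by
  have hEc : Continuous E := (E.mkContinuous 1 fun c ↦ by simpa using hE.contractive c).continuous
  have hEjc : Continuous fun a ↦ E (j a) :=
    ((E ∘ₗ j.toAlgHom.toLinearMap).mkContinuous 1 fun c ↦ by
      simpa using hEj.contractive c).continuous
  have h₁ := (hEc.tendsto _).comp ((hu.const_mul (j x)).mul_const (j y))
  have h₂ := (hEjc.tendsto _).comp ((hv.const_mul x).mul_const y)
  refine tendsto_nhds_unique h₁ (h₂.congr fun n ↦ (h n x y).symm)

lemma exists_of_dense (hE : IsCondExp jC E)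
    (hEj : IsCondExp jB (E ∘ₗ j.toAlgHom.toLinearMap))
    (hf : FaithfulGNS (E ∘ₗ j.toAlgHom.toLinearMap))
    (hd : Dense {c | ∃ a, IsCompression j E c a}) (c : C) : ∃ a, IsCompression j E c a := by
  obtain ⟨u, hu, hlim⟩ := mem_closure_iff_seq_limit.mp (hd c)
  choose v hv using hu
  have hcauchy : CauchySeq v := by
    refine Metric.cauchySeq_iff.mpr fun ε hε ↦ ?_
    obtain ⟨N, hN⟩ := Metric.cauchySeq_iff.mp hlim.cauchySeq ε hε
    refine ⟨N, fun m hm n hn ↦ lt_of_le_of_lt ?_ (hN m hm n hn)⟩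
    rw [dist_eq_norm, dist_eq_norm]
    exact ((hv m).sub (hv n)).norm_le hE hEj hf
  obtain ⟨a, ha⟩ := cauchySeq_tendsto_of_complete hcauchy
  exact ⟨a, of_tendsto hE hEj hv hlim ha⟩

lemma exists_eq_star_mul_self (hE : IsCondExp jC E)
    (hEj : IsCondExp jB (E ∘ₗ j.toAlgHom.toLinearMap))
    (hf : FaithfulGNS (E ∘ₗ j.toAlgHom.toLinearMap))
    (h : IsCompression j E (Star.star c * c) a) : ∃ b, a = Star.star b * b := by
  let _ := CStarAlgebra.spectralOrder A
  have := CStarAlgebra.spectralOrderedRing A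
  let _ := CStarAlgebra.spectralOrder C
  have := CStarAlgebra.spectralOrderedRing C
  rw [← CStarAlgebra.nonneg_iff_eq_star_mul_self]
  have hsa : IsSelfAdjoint a := by
    refine unique hE hEj hf ?_ h
    simpa using h.star hE
  rw [nonneg_iff_isSelfAdjoint_and_quasispectrumRestricts,
    quasispectrumRestricts_iff_spectrumRestricts]
  have hc := (SpectrumRestricts.nnreal_iff_nnnorm (.star_mul_self c) le_rfl).mp
    (SpectrumRestricts.nnreal_of_nonneg (star_mul_self_nonneg c))
  refine ⟨hsa, (SpectrumRestricts.nnreal_iff_nnnorm (t := ‖Star.star c * c‖₊) hsa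
    (h.norm_le hE hEj hf)).mpr (le_trans ?_ hc)⟩
  refine norm_le hE hEj hf (.sub ?_ h)
  have h₁ := (IsCompression.map j E 1).smul (‖Star.star c * c‖₊ : ℂ)
  simpa [Algebra.algebraMap_eq_smul_one] using h₁

/-- If a dense set of elements of `C` admits compressions to `A`, then the compression is a
conditional expectation. -/
theorem exists_condExp (hE : IsCondExp jC E) (hj : Function.Injective j)
    (hEj : IsCondExp jB (E ∘ₗ j.toAlgHom.toLinearMap))
    (hf : FaithfulGNS (E ∘ₗ j.toAlgHom.toLinearMap))
    (hd : Dense {c | ∃ a, IsCompression j E c a}) :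
    ∃ Φ : C →ₗ[ℂ] A, IsCondExp j Φ ∧ ∀ c a, IsCompression j E c a → Φ c = a := by
  choose Φ hΦ using exists_of_dense hE hEj hf hd
  have huniq : ∀ c a, IsCompression j E c a → Φ c = a := fun c a h ↦
    unique hE hEj hf (hΦ c) h
  refine ⟨{ toFun := Φ
            map_add' := fun c d ↦ huniq _ _ ((hΦ c).add (hΦ d))
            map_smul' := fun z c ↦ huniq _ _ ((hΦ c).smul z) }, ?_, huniq⟩
  exact
    { injective := hj
      left_inverse := fun a ↦ huniq _ _ (.map j E a)
      bimodule := fun z w c ↦ huniq _ _ ((hΦ c).mul_mul z w)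
      positive := fun c ↦ exists_eq_star_mul_self hE hEj hf (hΦ _)
      contractive := fun c ↦ norm_le hE hEj hf (hΦ c) }

end IsCompression

section Words

variable {I B C : Type*} {A : I → Type*} [CStarAlgebra B] [∀ i, CStarAlgebra (A i)]
  [CStarAlgebra C]

/-- A list of letters from the `A i` is reduced if all letters are centred and neighbouring
letters come from different `A i`. -/
structure IsReducedWord (φ : ∀ i, A i →ₗ[ℂ] B) (l : List (Σ i, A i)) : Prop where
  isChain : l.IsChain fun p q ↦ p.1 ≠ q.1
  centred : ∀ p ∈ l, φ p.1 p.2 = 0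

/-- The product in `C` of the letters of a word. -/
def wordProd (emb : ∀ i, A i →⋆ₐ[ℂ] C) (l : List (Σ i, A i)) : C :=
  (l.map fun p ↦ emb p.1 p.2).prod

/-- The span of the reduced words satisfying `K`, with coefficients in `B` on the left. -/
def wordSpan (φ : ∀ i, A i →ₗ[ℂ] B) (jC : B →⋆ₐ[ℂ] C) (emb : ∀ i, A i →⋆ₐ[ℂ] C)
    (K : List (Σ i, A i) → Prop) : Submodule ℂ C :=
  Submodule.span ℂ {c | ∃ b l, IsReducedWord φ l ∧ K l ∧ c = jC b * wordProd emb l}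

variable {jB : ∀ i, B →⋆ₐ[ℂ] A i} {φ : ∀ i, A i →ₗ[ℂ] B} {jC : B →⋆ₐ[ℂ] C}
  {emb : ∀ i, A i →⋆ₐ[ℂ] C} {E : C →ₗ[ℂ] B} {K : List (Σ i, A i) → Prop}

@[simp]
lemma wordProd_nil (emb : ∀ i, A i →⋆ₐ[ℂ] C) : wordProd emb [] = 1 := rfl

@[simp]
lemma wordProd_cons (emb : ∀ i, A i →⋆ₐ[ℂ] C) (p : Σ i, A i) (l : List (Σ i, A i)) :
    wordProd emb (p :: l) = emb p.1 p.2 * wordProd emb l := by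
  simp [wordProd]

lemma star_wordProd (emb : ∀ i, A i →⋆ₐ[ℂ] C) (l : List (Σ i, A i)) :
    star (wordProd emb l) = wordProd emb (l.reverse.map fun p ↦ ⟨p.1, star p.2⟩) := by
  induction l with
  | nil => simp
  | cons p l ih =>
    rw [wordProd_cons, star_mul, ih]
    simp [wordProd, map_star]

namespace IsReducedWord

lemma reverse_star (hce : ∀ i, IsCondExp (jB i) (φ i)) {l : List (Σ i, A i)}
    (h : IsReducedWord φ l) :
    IsReducedWord φ (l.reverse.map fun p ↦ ⟨p.1, star p.2⟩) where
  isChain := by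
    rw [List.isChain_map, List.isChain_reverse]
    exact h.isChain.imp fun p q hpq ↦ hpq.symm
  centred := by
    simp only [List.mem_map, List.mem_reverse]
    rintro _ ⟨p, hp, rfl⟩
    simp [(hce p.1).map_star, h.centred p hp]

lemma of_cons {p : Σ i, A i} {l : List (Σ i, A i)} (h : IsReducedWord φ (p :: l)) :
    IsReducedWord φ l :=
  ⟨(List.isChain_cons.mp h.isChain).2, fun q hq ↦ h.centred q (List.mem_cons_of_mem _ hq)⟩

lemma cons {p : Σ i, A i} {l : List (Σ i, A i)} (h : IsReducedWord φ l)
    (hp : φ p.1 p.2 = 0) (hne : ∀ q ∈ l.head?, p.1 ≠ q.1) : IsReducedWord φ (p :: l) :=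
  ⟨List.isChain_cons.mpr ⟨hne, h.isChain⟩, by simpa [hp] using h.centred⟩

end IsReducedWord

lemma IsCondExp.map_sub_self {A : Type*} [CStarAlgebra A] {j : B →⋆ₐ[ℂ] A} {E : A →ₗ[ℂ] B}
    (hE : IsCondExp j E) (a : A) : E (a - j (E a)) = 0 := by
  rw [map_sub, hE.left_inverse, sub_self]

lemma mul_wordProd_mem_wordSpan (hce : ∀ i, IsCondExp (jB i) (φ i))
    (hcompat : ∀ i, (emb i).comp (jB i) = jC) (hK : ∀ p l, K l → K (p :: l))
    {i : I} (a : A i) {l : List (Σ i, A i)} (hl : IsReducedWord φ l) (hKl : K l)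
    (hne : ∀ q ∈ l.head?, i ≠ q.1) : emb i a * wordProd emb l ∈ wordSpan φ jC emb K := by
  have h₁ : jC 1 * wordProd emb (⟨i, a - jB i (φ i a)⟩ :: l) ∈ wordSpan φ jC emb K :=
    Submodule.subset_span ⟨1, _, hl.cons ((hce i).map_sub_self a) hne, hK _ _ hKl, rfl⟩
  have h₂ : jC (φ i a) * wordProd emb l ∈ wordSpan φ jC emb K :=
    Submodule.subset_span ⟨_, l, hl, hKl, rfl⟩
  convert add_mem h₁ h₂ using 1
  have h₃ : emb i (jB i (φ i a)) = jC (φ i a) := DFunLike.congr_fun (hcompat i) _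
  simp [h₃, sub_mul]

lemma mul_mem_wordSpan (hce : ∀ i, IsCondExp (jB i) (φ i))
    (hcompat : ∀ i, (emb i).comp (jB i) = jC) (hK : ∀ p l, K l → K (p :: l))
    {i : I} (hK' : ∀ (a : A i) l, K (⟨i, a⟩ :: l) → K l) (a : A i) {c : C}
    (hc : c ∈ wordSpan φ jC emb K) : emb i a * c ∈ wordSpan φ jC emb K := by
  induction hc using Submodule.span_induction with
  | zero => simp
  | add x y _ _ hx hy => rw [mul_add]; exact add_mem hx hy
  | smul z x _ hx => rw [mul_smul_comm]; exact Submodule.smul_mem _ _ hx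
  | mem x hx =>
    obtain ⟨b, l, hl, hKl, rfl⟩ := hx
    have hb : emb i (jB i b) = jC b := DFunLike.congr_fun (hcompat i) b
    rw [← hb, ← mul_assoc, ← map_mul]
    by_cases hne : ∀ q ∈ l.head?, i ≠ q.1
    · exact mul_wordProd_mem_wordSpan hce hcompat hK _ hl hKl hne
    · rcases l with _ | ⟨⟨i', a'⟩, l⟩
      · simp at hne
      · obtain rfl : i = i' := by simpa using hne
        rw [wordProd_cons, ← mul_assoc, ← map_mul]
        exact mul_wordProd_mem_wordSpan hce hcompat hK _ hl.of_cons (hK' _ _ hKl)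
          (List.isChain_cons.mp hl.isChain).1

namespace IsReducedAmalgProd

variable (hce : ∀ i, IsCondExp (jB i) (φ i)) (hprod : IsReducedAmalgProd B jB φ jC emb E)
include hprod

lemma map_wordProd_eq_zero {l : List (Σ i, A i)} (hl : IsReducedWord φ l) (hne : l ≠ []) :
    E (wordProd emb l) = 0 := by
  obtain ⟨n, hn⟩ : ∃ n, l.length = n + 1 :=
    Nat.exists_eq_succ_of_ne_zero (List.length_pos_iff.mpr hne).ne'
  have key := hprod.free n (fun k ↦ (l.get (k.cast hn.symm)).1)
    (fun k ↦ List.isChain_iff_getElem.mp hl.isChain k (by omega))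
    (fun k ↦ (l.get (k.cast hn.symm)).2) (fun k ↦ hl.centred _ (List.get_mem _ _))
  have hlist : (List.ofFn fun k : Fin (n + 1) ↦
      emb (l.get (k.cast hn.symm)).1 (l.get (k.cast hn.symm)).2) =
      l.map fun p ↦ emb p.1 p.2 := by
    apply List.ext_getElem <;> simp [hn, -List.ofFn_succ]
  rwa [hlist] at key

include hce

lemma emb_mul_wordProd_mem_wordSpan {i₀ : I} (x : A i₀) {l : List (Σ i, A i)}
    (hl : IsReducedWord φ l) (hne : ∃ p ∈ l, p.1 ≠ i₀) :
    emb i₀ x * wordProd emb l ∈ wordSpan φ jC emb fun l ↦ ∃ p ∈ l, p.1 ≠ i₀ := by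
  have h₁ : emb i₀ x * (jC 1 * wordProd emb l) ∈
      wordSpan φ jC emb fun l ↦ ∃ p ∈ l, p.1 ≠ i₀ :=
    mul_mem_wordSpan hce hprod.compat
      (fun p l ⟨q, hq, h⟩ ↦ ⟨q, List.mem_cons_of_mem _ hq, h⟩)
      (fun a l ↦ by simp) x (Submodule.subset_span ⟨1, l, hl, hne, rfl⟩)
  rwa [map_one, one_mul] at h₁

lemma map_mul_wordProd_eq_zero {i₀ : I} (x : A i₀) {l : List (Σ i, A i)}
    (hl : IsReducedWord φ l) (hne : ∃ p ∈ l, p.1 ≠ i₀) : E (emb i₀ x * wordProd emb l) = 0 := by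
  refine (Submodule.span_le (p := LinearMap.ker E)).mpr ?_
    (hprod.emb_mul_wordProd_mem_wordSpan hce x hl hne)
  rintro _ ⟨b, l, hl, ⟨p, hp, -⟩, rfl⟩
  rw [SetLike.mem_coe, LinearMap.mem_ker, hprod.condExp.map_left_mul,
    hprod.map_wordProd_eq_zero hl (List.ne_nil_of_mem hp), mul_zero]

/-- Reduced words with a letter outside of `A i₀` compress to `0`. -/
lemma isCompression_wordProd {i₀ : I} {l : List (Σ i, A i)} (hl : IsReducedWord φ l)
    (hne : ∃ p ∈ l, p.1 ≠ i₀) : IsCompression (emb i₀) E (wordProd emb l) 0 := fun x y ↦ by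
  rw [mul_zero, zero_mul, map_zero, map_zero]
  refine (Submodule.span_le
    (p := LinearMap.ker (E ∘ₗ LinearMap.mulRight ℂ (emb i₀ y)))).mpr ?_
    (hprod.emb_mul_wordProd_mem_wordSpan hce x hl hne)
  rintro _ ⟨b, l, hl, ⟨p, hp, hpi⟩, rfl⟩
  rw [SetLike.mem_coe, LinearMap.mem_ker]
  change E (jC b * wordProd emb l * emb i₀ y) = 0
  rw [mul_assoc, hprod.condExp.map_left_mul, ← star_star (E _), ← hprod.condExp.map_star,
    star_mul, star_wordProd, ← StarHomClass.map_star (emb i₀), hprod.map_mul_wordProd_eq_zero hce _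
      (hl.reverse_star hce)
      ⟨⟨p.1, star p.2⟩, List.mem_map.mpr ⟨p, List.mem_reverse.mpr hp, rfl⟩, hpi⟩,
    star_zero, mul_zero]

lemma exists_isCompression_of_mem_wordSpan (i₀ : I) {c : C}
    (hc : c ∈ wordSpan φ jC emb fun _ ↦ True) : ∃ a, IsCompression (emb i₀) E c a := by
  induction hc using Submodule.span_induction with
  | zero => exact ⟨0, .zero _ _⟩
  | add x y _ _ hx hy =>
    obtain ⟨a, ha⟩ := hx
    obtain ⟨b, hb⟩ := hy
    exact ⟨_, ha.add hb⟩
  | smul z x _ hx =>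
    obtain ⟨a, ha⟩ := hx
    exact ⟨_, ha.smul z⟩
  | mem x hx =>
    obtain ⟨b, l, hl, -, rfl⟩ := hx
    suffices h : ∃ a, IsCompression (emb i₀) E (wordProd emb l) a by
      obtain ⟨a, ha⟩ := h
      have h₁ := ha.mul_mul (jB i₀ b) 1
      have h₂ : emb i₀ (jB i₀ b) = jC b := DFunLike.congr_fun (hprod.compat i₀) _
      rw [map_one, mul_one, h₂] at h₁
      exact ⟨_, h₁⟩
    by_cases hne : ∃ p ∈ l, p.1 ≠ i₀
    · exact ⟨0, hprod.isCompression_wordProd hce hl hne⟩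
    · push Not at hne
      have hmem : wordProd emb l ∈ (emb i₀).range := by
        refine list_prod_mem ?_
        simp only [List.mem_map]
        rintro _ ⟨⟨i, a⟩, hp, rfl⟩
        obtain rfl : i = i₀ := hne _ hp
        exact ⟨a, rfl⟩
      obtain ⟨a, ha⟩ := hmem
      exact ⟨a, ha ▸ .map _ _ a⟩

lemma dense_wordSpan : Dense (wordSpan φ jC emb fun _ ↦ True : Set C) := by
  refine hprod.generating.mono fun c hc ↦ ?_
  have h₁ : (∀ v ∈ wordSpan φ jC emb fun _ ↦ True, c * v ∈ wordSpan φ jC emb fun _ ↦ True) ∧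
      ∀ v ∈ wordSpan φ jC emb fun _ ↦ True, star c * v ∈ wordSpan φ jC emb fun _ ↦ True := by
    have hmul : ∀ i (a : A i), ∀ v ∈ wordSpan φ jC emb fun _ ↦ True,
        emb i a * v ∈ wordSpan φ jC emb fun _ ↦ True := fun i a v hv ↦
      mul_mem_wordSpan hce hprod.compat (fun _ _ _ ↦ trivial) (fun _ _ _ ↦ trivial) a hv
    induction hc using StarAlgebra.adjoin_induction with
    | mem x hx =>
      obtain ⟨i, a, rfl⟩ := Set.mem_iUnion.mp hx
      exact ⟨hmul i a, fun v hv ↦ by rw [← map_star]; exact hmul i _ v hv⟩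
    | algebraMap r =>
      simp only [Algebra.algebraMap_eq_smul_one, star_smul, star_one, smul_mul_assoc, one_mul]
      exact ⟨fun v hv ↦ Submodule.smul_mem _ _ hv, fun v hv ↦ Submodule.smul_mem _ _ hv⟩
    | add x y _ _ hx hy =>
      simp only [star_add, add_mul]
      exact ⟨fun v hv ↦ add_mem (hx.1 v hv) (hy.1 v hv),
        fun v hv ↦ add_mem (hx.2 v hv) (hy.2 v hv)⟩
    | mul x y _ _ hx hy =>
      simp only [star_mul, mul_assoc]
      exact ⟨fun v hv ↦ hx.1 _ (hy.1 v hv), fun v hv ↦ hy.2 _ (hx.2 v hv)⟩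
    | star x _ hx => exact ⟨hx.2, by simpa using hx.1⟩
  have h₂ : (1 : C) ∈ wordSpan φ jC emb fun _ ↦ True :=
    Submodule.subset_span ⟨1, [], ⟨.nil, by simp⟩, trivial, by simp⟩
  simpa using h₁.1 1 h₂

end IsReducedAmalgProd

end Words

/-- **Lemma (CondExpA).**  Let `B` be a unital C⋆-algebra, `I` a set, and for every
`i ∈ I` let `A i` be a unital C⋆-algebra containing a copy of `B` as a unital
C⋆-subalgebra (via `jB i`), with a conditional expectation `φ i : A i → B` whose GNS
representation is faithful.  Let `(C, E) = (*_B)_{i ∈ I}(A i, φ i)` be the reduced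
amalgamated free product, with each `A i` viewed as a C⋆-subalgebra of `C` via the
canonical embedding `emb i`.  Then for every `i₀ ∈ I` there exists a conditional
expectation `Φ : C → A i₀` such that `Φ` restricted to `A i` equals `φ i` (composed with
the inclusion of `B` into `A i₀`) for every `i ≠ i₀`, and `Φ (a 1 * a 2 * ⋯ * a n) = 0`
whenever `n ≥ 2`, `a j ∈ A (ι j)` with `φ (ι j) (a j) = 0` and
`ι 1 ≠ ι 2, …, ι (n-1) ≠ ι n`. -/
theorem exists_condExp_onto_free_factor
    {I : Type*} (B : Type*) [CStarAlgebra B] (A : I → Type*) [∀ i, CStarAlgebra (A i)]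
    (jB : ∀ i, B →⋆ₐ[ℂ] A i) (φ : ∀ i, A i →ₗ[ℂ] B)
    (hce : ∀ i, IsCondExp (jB i) (φ i)) (hfaith : ∀ i, FaithfulGNS (φ i))
    {C : Type*} [CStarAlgebra C] (jC : B →⋆ₐ[ℂ] C) (emb : ∀ i, A i →⋆ₐ[ℂ] C)
    (E : C →ₗ[ℂ] B) (hprod : IsReducedAmalgProd B jB φ jC emb E) (i₀ : I) :
    ∃ Φ : C →ₗ[ℂ] A i₀,
      IsCondExp (emb i₀) Φ ∧
      (∀ i, i ≠ i₀ → ∀ a : A i, Φ (emb i a) = jB i₀ (φ i a)) ∧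
      (∀ (n : ℕ) (ι : Fin (n + 2) → I), (∀ k : Fin (n + 1), ι k.castSucc ≠ ι k.succ) →
        ∀ a : (j : Fin (n + 2)) → A (ι j), (∀ j, φ (ι j) (a j) = 0) →
          Φ ((List.ofFn fun j => emb (ι j) (a j)).prod) = 0) := by
  have hEφ : E ∘ₗ (emb i₀).toAlgHom.toLinearMap = φ i₀ :=
    LinearMap.ext fun a ↦ hprod.restrict i₀ a
  obtain ⟨Φ, hΦ, huniq⟩ := IsCompression.exists_condExp hprod.condExp (hprod.emb_injective i₀)
    (jB := jB i₀) (hEφ ▸ hce i₀) (hEφ ▸ hfaith i₀)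
    ((hprod.dense_wordSpan hce).mono fun c hc ↦
      hprod.exists_isCompression_of_mem_wordSpan hce i₀ hc)
  refine ⟨Φ, hΦ, fun i hi a ↦ ?_, fun n ι hι a ha ↦ ?_⟩
  · refine huniq _ _ ?_
    have h₁ : IsReducedWord φ [⟨i, a - jB i (φ i a)⟩] :=
      ⟨.singleton _, by simpa using (hce i).map_sub_self a⟩
    have h₂ := (hprod.isCompression_wordProd hce (i₀ := i₀) h₁ (by simpa using hi)).add
      (.map (emb i₀) E (jB i₀ (φ i a)))
    have h₃ : emb i (jB i (φ i a)) = emb i₀ (jB i₀ (φ i a)) :=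
      (DFunLike.congr_fun (hprod.compat i) _).trans (DFunLike.congr_fun (hprod.compat i₀) _).symm
    simpa [h₃] using h₂
  · refine huniq _ _ ?_
    have h₁ : IsReducedWord φ (List.ofFn fun k ↦ (⟨ι k, a k⟩ : Σ i, A i)) := by
      refine ⟨List.isChain_ofFn.mpr fun k hk ↦ hι ⟨k, by omega⟩, fun p hp ↦ ?_⟩
      obtain ⟨k, rfl⟩ := (List.mem_ofFn' _ _).mp hp
      exact ha k
    have h₂ : ∃ p ∈ List.ofFn fun k ↦ (⟨ι k, a k⟩ : Σ i, A i), p.1 ≠ i₀ := by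
      by_contra! h
      have h' : ∀ k, ι k = i₀ := fun k ↦ h ⟨ι k, a k⟩ ((List.mem_ofFn' _ _).mpr ⟨k, rfl⟩)
      exact hι 0 ((h' _).trans (h' _).symm)
    have h₃ := hprod.isCompression_wordProd hce h₁ h₂
    rwa [wordProd, List.map_ofFn] at h₃
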